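/- arXiv:1409.2667 — 3 statements merged into one kernel-verified Lean document; each statement's English description precedes it below -/
import Mathlib

section
/- Let 0 < a < 2 and let f : ℕ × ℕ → ℂ satisfy the cross-ratio equation for all n, m ≥ 0 and the constraint for all n, m (interior and boundary versions), with all differences u_{i,j} = f(i+1,j) − f(i,j) and v_{i,j} = f(i,j+1) − f(i,j) nonzero, f(i+1,j) ≠ f(i−1,j) and f(i,j+1) ≠ f(i,j−1) whenever these occur, and additionally u_{i,j} + u_{i−1,j} ≠ 0 and v_{i,j} + v_{i,j−1} ≠ 0 whenever these expressions occur. Then for all n, m ≥ 1 and all λ ∈ ℂ \ {−1, 0, 1}: [[0, 0],[1/u_{n,m}, 0]] = A_{n+1,m}(λ)·U_{n,m}(λ) − U_{n,m}(λ)·A_{n,m}(λ), i.e. the λ-derivative of U_{n,m}(λ) equals A_{n+1,m}(λ)U_{n,m}(λ) − U_{n,m}(λ)A_{n,m}(λ). -/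
/-- Horizontal difference `u_{n,m} = f(n+1,m) - f(n,m)`. -/
noncomputable def uDiff (f : ℕ × ℕ → ℂ) (n m : ℕ) : ℂ := f (n + 1, m) - f (n, m)

/-- Vertical difference `v_{n,m} = f(n,m+1) - f(n,m)`. -/
noncomputable def vDiff (f : ℕ × ℕ → ℂ) (n m : ℕ) : ℂ := f (n, m + 1) - f (n, m)

/-- The Lax matrix `U_{n,m}(λ)`. -/
noncomputable def LaxU (f : ℕ × ℕ → ℂ) (n m : ℕ) (l : ℂ) : Matrix (Fin 2) (Fin 2) ℂ :=
  !![1, -uDiff f n m; l / uDiff f n m, 1]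

/-- The Lax matrix `V_{n,m}(λ)`. -/
noncomputable def LaxV (f : ℕ × ℕ → ℂ) (n m : ℕ) (l : ℂ) : Matrix (Fin 2) (Fin 2) ℂ :=
  !![1, -vDiff f n m; -(l / vDiff f n m), 1]

/-- The residue matrix `B_{n,m}` (for `n ≥ 1`; `n - 1` is truncated subtraction). -/
noncomputable def Bres (f : ℕ × ℕ → ℂ) (n m : ℕ) : Matrix (Fin 2) (Fin 2) ℂ :=
  (-(n : ℂ) / (uDiff f n m + uDiff f (n - 1) m)) •
    !![uDiff f n m, uDiff f n m * uDiff f (n - 1) m; 1, uDiff f (n - 1) m]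

/-- The residue matrix `C_{n,m}` (for `m ≥ 1`; `m - 1` is truncated subtraction). -/
noncomputable def Cres (f : ℕ × ℕ → ℂ) (n m : ℕ) : Matrix (Fin 2) (Fin 2) ℂ :=
  (-(m : ℂ) / (vDiff f n m + vDiff f n (m - 1))) •
    !![vDiff f n m, vDiff f n m * vDiff f n (m - 1); 1, vDiff f n (m - 1)]

/-- The residue matrix `D_{n,m}`. -/
noncomputable def Dres (a : ℝ) (f : ℕ × ℕ → ℂ) (n m : ℕ) : Matrix (Fin 2) (Fin 2) ℂ :=
  !![-(a : ℂ) / 4, -((a : ℂ) / 2) * f (n, m); 0, (a : ℂ) / 4]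

/-- The coefficient matrix `A_{n,m}(λ) = -B_{n,m}/(1+λ) + C_{n,m}/(1-λ) + D_{n,m}/λ`. -/
noncomputable def Acoef (a : ℝ) (f : ℕ × ℕ → ℂ) (n m : ℕ) (l : ℂ) :
    Matrix (Fin 2) (Fin 2) ℂ :=
  (-(1 / (1 + l))) • Bres f n m + (1 / (1 - l)) • Cres f n m + (1 / l) • Dres a f n m

/-- The cross-ratio equation holds at every `(n,m)`, with nonzero differences. -/
def CrossRatioAll (f : ℕ × ℕ → ℂ) : Prop :=
  ∀ n m : ℕ,
    f (n + 1, m) - f (n, m) ≠ 0 ∧ f (n, m + 1) - f (n, m) ≠ 0 ∧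
    f (n + 1, m + 1) - f (n + 1, m) ≠ 0 ∧ f (n + 1, m + 1) - f (n, m + 1) ≠ 0 ∧
    (f (n, m) - f (n + 1, m)) * (f (n + 1, m + 1) - f (n, m + 1)) =
      -((f (n + 1, m) - f (n + 1, m + 1)) * (f (n, m + 1) - f (n, m)))

/-- The nonautonomous constraint: interior version for `n, m ≥ 1`, and the boundary
versions with the `2n`-term omitted when `n = 0` and the `2m`-term omitted when
`m = 0` (at `(0,0)` both terms are omitted). -/
def ConstraintAll (a : ℝ) (f : ℕ × ℕ → ℂ) : Prop :=
  (∀ n m : ℕ,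
    f (n + 2, m + 1) ≠ f (n, m + 1) ∧ f (n + 1, m + 2) ≠ f (n + 1, m) ∧
    (a : ℂ) * f (n + 1, m + 1) =
      (2 * (n + 1) : ℂ) *
          ((f (n + 2, m + 1) - f (n + 1, m + 1)) * (f (n + 1, m + 1) - f (n, m + 1))) /
          (f (n + 2, m + 1) - f (n, m + 1)) +
        (2 * (m + 1) : ℂ) *
          ((f (n + 1, m + 2) - f (n + 1, m + 1)) * (f (n + 1, m + 1) - f (n + 1, m))) /
          (f (n + 1, m + 2) - f (n + 1, m))) ∧
  (∀ n : ℕ,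
    f (n + 2, 0) ≠ f (n, 0) ∧
    (a : ℂ) * f (n + 1, 0) =
      (2 * (n + 1) : ℂ) * ((f (n + 2, 0) - f (n + 1, 0)) * (f (n + 1, 0) - f (n, 0))) /
        (f (n + 2, 0) - f (n, 0))) ∧
  (∀ m : ℕ,
    f (0, m + 2) ≠ f (0, m) ∧
    (a : ℂ) * f (0, m + 1) =
      (2 * (m + 1) : ℂ) * ((f (0, m + 2) - f (0, m + 1)) * (f (0, m + 1) - f (0, m))) /
        (f (0, m + 2) - f (0, m))) ∧
  (a : ℂ) * f (0, 0) = 0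

/-- All the nondegeneracy conditions: all differences `u_{i,j}`, `v_{i,j}` are nonzero,
`f(i+1,j) ≠ f(i-1,j)` and `f(i,j+1) ≠ f(i,j-1)` whenever these occur, and the sums
`u_{i,j} + u_{i-1,j}`, `v_{i,j} + v_{i,j-1}` are nonzero whenever they occur. -/
def NondegenerateAll (f : ℕ × ℕ → ℂ) : Prop :=
  (∀ n m : ℕ, uDiff f n m ≠ 0 ∧ vDiff f n m ≠ 0) ∧
  (∀ n m : ℕ, f (n + 2, m) ≠ f (n, m) ∧ f (n, m + 2) ≠ f (n, m)) ∧
  (∀ n m : ℕ, uDiff f (n + 1) m + uDiff f n m ≠ 0 ∧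
    vDiff f n (m + 1) + vDiff f n m ≠ 0)

/-- Relations between the vertical differences on neighbouring columns. -/
lemma lax_column_aux (u v v' w w' M S R : ℂ) (hu : u ≠ 0)
    (hs : v + v' ≠ 0) (ht : w + w' ≠ 0)
    (h1 : u ^ 2 + u * w - u * v + w * v = 0)
    (h2 : u ^ 2 + u * v' - u * w' + w' * v' = 0)
    (hS : S * (v + v') = M) (hR : R * (w + w') = M) :
    2 * u ^ 2 * R = S * (u + v) * (u - v') ∧
    2 * u * (R * w) = S * (v - u) * (u - v') ∧
    2 * u * (R * w') = S * (u + v) * (u + v') ∧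
    2 * (R * w * w') = S * (v - u) * (u + v') := by
  have key : (w + w') * ((u + v) * (u - v')) = 2 * u ^ 2 * (v + v') := by
    linear_combination (u - v') * h1 - (u + v) * h2
  have e1 : 2 * u ^ 2 * R = S * (u + v) * (u - v') := by
    apply mul_right_cancel₀ ht
    apply mul_right_cancel₀ hs
    linear_combination 2 * u ^ 2 * (v + v') * hR - (w + w') * (u + v) * (u - v') * hS - M * key
  have e2 : 2 * u * (R * w) = S * (v - u) * (u - v') := by
    apply mul_left_cancel₀ hu
    linear_combination w * e1 + S * (u - v') * h1
  have e3 : 2 * u * (R * w') = S * (u + v) * (u + v') := by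
    apply mul_left_cancel₀ hu
    linear_combination w' * e1 - S * (u + v) * h2
  refine ⟨e1, e2, e3, ?_⟩
  apply mul_left_cancel₀ hu
  apply mul_left_cancel₀ hu
  linear_combination u * w' * e2 - S * (v - u) * u * h2

/-- The matrix identity in terms of scalars. -/
lemma lax_matrix_aux (u u' p v v' w w' g n m a l : ℂ) (hu : u ≠ 0)
    (su : u + p ≠ 0) (su2 : u' + u ≠ 0) (sv : v + v' ≠ 0) (sw : w + w' ≠ 0)
    (h1 : u ^ 2 + u * w - u * v + w * v = 0)
    (h2 : u ^ 2 + u * v' - u * w' + w' * v' = 0)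
    (k1 : a * g = 2 * (n + 1) * (u * p) / (u + p) + 2 * (m + 1) * (v * v') / (v + v'))
    (k2 : a * (g + u) = 2 * (n + 1 + 1) * (u' * u) / (u' + u)
      + 2 * (m + 1) * (w * w') / (w + w'))
    (hl1 : l ≠ -1) (hl0 : l ≠ 0) (hl2 : l ≠ 1) :
    (!![0, 0; 1 / u, 0] : Matrix (Fin 2) (Fin 2) ℂ) =
      ((-(1 / (1 + l))) • ((-(n + 1 + 1) / (u' + u)) • !![u', u' * u; 1, u])
        + (1 / (1 - l)) • ((-(m + 1) / (w + w')) • !![w, w * w'; 1, w'])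
        + (1 / l) • !![-a / 4, -(a / 2) * (g + u); 0, a / 4]) * !![1, -u; l / u, 1]
      - !![1, -u; l / u, 1] *
      ((-(1 / (1 + l))) • ((-(n + 1) / (u + p)) • !![u, u * p; 1, p])
        + (1 / (1 - l)) • ((-(m + 1) / (v + v')) • !![v, v * v'; 1, v'])
        + (1 / l) • !![-a / 4, -(a / 2) * g; 0, a / 4]) := by
  obtain ⟨P, hP⟩ : ∃ P, P = (n + 1 + 1) / (u' + u) := ⟨_, rfl⟩
  obtain ⟨Q, hQ⟩ : ∃ Q, Q = (n + 1) / (u + p) := ⟨_, rfl⟩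
  obtain ⟨R, hR⟩ : ∃ R, R = (m + 1) / (w + w') := ⟨_, rfl⟩
  obtain ⟨S, hS⟩ : ∃ S, S = (m + 1) / (v + v') := ⟨_, rfl⟩
  have k1' : a * g = 2 * Q * u * p + 2 * S * v * v' := by rw [k1, hQ, hS]; ring
  have k2' : a * (g + u) = 2 * P * u' * u + 2 * R * w * w' := by rw [k2, hP, hR]; ring
  rw [neg_div (u' + u), neg_div (u + p), neg_div (w + w'), neg_div (v + v'), ← hP, ← hQ, ← hR, ← hS]
  rw [eq_div_iff su2] at hP
  rw [eq_div_iff su] at hQ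
  rw [eq_div_iff sw] at hR
  rw [eq_div_iff sv] at hS
  obtain ⟨e1, e2, e3, e4⟩ := lax_column_aux u v v' w w' (m + 1) S R hu sv sw h1 h2 hS hR
  have hx : 1 + l ≠ 0 := fun h => hl1 (by linear_combination h)
  have hy : 1 - l ≠ 0 := fun h => hl2 (by linear_combination -h)
  clear k1 k2 h1 h2 su su2 sv sw hl1 hl2
  ext i j
  fin_cases i <;> fin_cases j <;>
    simp only [Matrix.mul_fin_two, Matrix.smul_of, Matrix.smul_cons, smul_eq_mul, Matrix.smul_empty,
      Matrix.of_add_of, Matrix.of_sub_of, Matrix.add_cons, Matrix.sub_cons, Matrix.head_cons,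
      Matrix.tail_cons, Matrix.empty_add_empty, Matrix.empty_sub_empty, Matrix.of_apply,
      Matrix.cons_val, Matrix.cons_val_zero, Matrix.cons_val_one, Fin.zero_eta, Fin.mk_one]
  all_goals
    try rw [div_eq_mul_one_div l u]
    obtain ⟨k, hk⟩ : ∃ k, k = 1 / u := ⟨_, rfl⟩
    obtain ⟨x, hxx⟩ : ∃ x, x = 1 / (1 + l) := ⟨_, rfl⟩
    obtain ⟨y, hyy⟩ : ∃ y, y = 1 / (1 - l) := ⟨_, rfl⟩
    obtain ⟨z, hz⟩ : ∃ z, z = 1 / l := ⟨_, rfl⟩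
    rw [← hxx, ← hyy, ← hz]
    try rw [← hk]
    rw [eq_div_iff hu] at hk
    rw [eq_div_iff hx] at hxx
    rw [eq_div_iff hy] at hyy
    rw [eq_div_iff hl0] at hz
    clear hx hy hl0 hu
  · linear_combination -(P * u' * u * k * hxx + R * w * w' * k * hyy - (a / 2) * (g + u) * k * hz
      - x * P * u' * hk - (k / 2) * k2'
      + y * (-(k / 2) * e4 + R * w * hk - (k / 2) * e2 - S * (v - u) * hk))
  · linear_combination -(y * (e2 / 2 - e4 / 2))
  · linear_combination -((P - Q) * u * k * hxx - (-R * w' + S * v) * k * hyy + (a / 2) * k * hz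
      - x * (P - Q) * hk
      + y * (R * (u * k + 1) * hk - (k ^ 2 / 2) * e1 + R * w' * k * hk - (k ^ 2 / 2) * e3
        - S * (u * k + 1) * hk - S * v * k * hk)
      + k * hP - k * hQ + k ^ 2 * ((k2' - k1') / 2 + e4 / 2 + e3 / 2)
      - k * (-P * u' + Q * p + R * w' - S * v + a / 2) * hk)
  · linear_combination -(-Q * u * p * k * hxx - S * v * v' * k * hyy + (a / 2) * g * k * hz
      + (k / 2) * k1' + x * Q * p * hk
      + y * (-S * v' * hk + R * w' * hk - (k / 2) * e3 - u * R * hk + (k / 2) * e1))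

/-- Isomonodromy relation for `U`: for all `n, m ≥ 1` and `λ ∉ {-1, 0, 1}`,
`dU_{n,m}/dλ = [[0,0],[1/u_{n,m},0]] = A_{n+1,m}(λ) U_{n,m}(λ) - U_{n,m}(λ) A_{n,m}(λ)`. -/
theorem lax_U_lambda_equation (a : ℝ) (ha : 0 < a) (ha2 : a < 2) (f : ℕ × ℕ → ℂ)
    (hcr : CrossRatioAll f) (hcon : ConstraintAll a f) (hnd : NondegenerateAll f) :
    ∀ n m : ℕ, 1 ≤ n → 1 ≤ m → ∀ l : ℂ, l ≠ -1 → l ≠ 0 → l ≠ 1 →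
      (!![0, 0; 1 / uDiff f n m, 0] : Matrix (Fin 2) (Fin 2) ℂ) =
        Acoef a f (n + 1) m l * LaxU f n m l - LaxU f n m l * Acoef a f n m l := by
  intro n m hn hm l hl1 hl0 hl2
  obtain ⟨n, rfl⟩ : ∃ k, n = k + 1 := ⟨n - 1, by omega⟩
  obtain ⟨m, rfl⟩ : ∃ k, m = k + 1 := ⟨m - 1, by omega⟩
  obtain ⟨hnz, -, hsum⟩ := hnd
  have hu := (hnz (n + 1) (m + 1)).1
  have su := (hsum n (m + 1)).1
  have su2 := (hsum (n + 1) (m + 1)).1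
  have sv := (hsum (n + 1) m).2
  have sv2 := (hsum (n + 2) m).2
  have c1 := (hcr (n + 1) (m + 1)).2.2.2.2
  have c2 := (hcr (n + 1) m).2.2.2.2
  have k1 := (hcon.1 n m).2.2
  have k2 := (hcon.1 (n + 1) m).2.2
  have hF : f (n + 2, m + 1) = f (n + 1, m + 1) + uDiff f (n + 1) (m + 1) := by
    simp only [uDiff]; ring
  simp only [Acoef, Bres, Cres, Dres, LaxU, Nat.add_sub_cancel]
  have d1 : f (n + 2, m + 1) - f (n, m + 1) = uDiff f (n + 1) (m + 1) + uDiff f n (m + 1) := by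
    simp only [uDiff]; ring
  have d2 : f (n + 1, m + 2) - f (n + 1, m) = vDiff f (n + 1) (m + 1) + vDiff f (n + 1) m := by
    simp only [vDiff]; ring
  have d3 : f (n + 1 + 2, m + 1) - f (n + 1, m + 1)
      = uDiff f (n + 2) (m + 1) + uDiff f (n + 1) (m + 1) := by
    simp only [uDiff]; ring
  have d4 : f (n + 1 + 1, m + 2) - f (n + 1 + 1, m)
      = vDiff f (n + 2) (m + 1) + vDiff f (n + 2) m := by
    simp only [vDiff]; ring
  rw [d1, d2] at k1
  rw [d3, d4] at k2
  have h1 : (uDiff f (n + 1) (m + 1)) ^ 2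
      + uDiff f (n + 1) (m + 1) * vDiff f (n + 2) (m + 1)
      - uDiff f (n + 1) (m + 1) * vDiff f (n + 1) (m + 1)
      + vDiff f (n + 2) (m + 1) * vDiff f (n + 1) (m + 1) = 0 := by
    simp only [uDiff, vDiff]
    linear_combination -c1
  have h2 : (uDiff f (n + 1) (m + 1)) ^ 2
      + uDiff f (n + 1) (m + 1) * vDiff f (n + 1) m
      - uDiff f (n + 1) (m + 1) * vDiff f (n + 2) m
      + vDiff f (n + 2) m * vDiff f (n + 1) m = 0 := by
    simp only [uDiff, vDiff]
    linear_combination -c2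
  change _ = 2 * ((n : ℂ) + 1) * (uDiff f (n + 1) (m + 1) * uDiff f n (m + 1)) / _
    + 2 * ((m : ℂ) + 1) * (vDiff f (n + 1) (m + 1) * vDiff f (n + 1) m) / _ at k1
  change _ * f (n + 2, m + 1) = 2 * (((n + 1 : ℕ) : ℂ) + 1)
      * (uDiff f (n + 2) (m + 1) * uDiff f (n + 1) (m + 1)) / _
    + 2 * ((m : ℂ) + 1) * (vDiff f (n + 2) (m + 1) * vDiff f (n + 2) m) / _ at k2
  change f (n + 1 + 1, m + 1) = _ at hF
  change _ * f (n + 1 + 1, m + 1) = _ at k2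
  rw [hF] at k2 ⊢
  clear c1 c2 d1 d2 d3 d4 hcr hcon hF
  push_cast at k1 k2 ⊢
  exact lax_matrix_aux _ _ _ _ _ _ _ _ n m _ l hu su su2 sv sv2 h1 h2 k1 k2 hl1 hl0 hl2
end

section
/- Let 0 < a < 2 and let f : ℕ × ℕ → ℂ satisfy the cross-ratio equation for all n, m ≥ 0 and the constraint for all n, m (interior and boundary versions), with all differences u_{i,j} = f(i+1,j) − f(i,j) and v_{i,j} = f(i,j+1) − f(i,j) nonzero, f(i+1,j) ≠ f(i−1,j) and f(i,j+1) ≠ f(i,j−1) whenever these occur, and additionally u_{i,j} + u_{i−1,j} ≠ 0 and v_{i,j} + v_{i,j−1} ≠ 0 whenever these expressions occur. Then for all n, m ≥ 1 and all λ ∈ ℂ \ {−1, 0, 1}: [[0, 0],[−1/v_{n,m}, 0]] = A_{n,m+1}(λ)·V_{n,m}(λ) − V_{n,m}(λ)·A_{n,m}(λ), i.e. the λ-derivative of V_{n,m}(λ) equals A_{n,m+1}(λ)V_{n,m}(λ) − V_{n,m}(λ)A_{n,m}(λ). -/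
/-- The Lax equation in terms of abstract matrix entries, with everything already eliminated. -/
theorem lax_aux (A F F' b b' g g' u w u' w' v vm vp N M l : ℂ)
    (hu : u ≠ 0) (hw : w ≠ 0) (hv : v ≠ 0)
    (hl1 : 1 + l ≠ 0) (hl0 : l ≠ 0) (hl2 : 1 - l ≠ 0)
    (hs : u + w ≠ 0) (hs' : u' + w' ≠ 0)
    (hb : b * (u + w) = N) (hb' : b' * (u' + w') = N)
    (hg : g * (v + vm) = M) (hg' : g' * (vp + v) = M + 1)
    (c1 : u' * (u + v) = v * (u - v)) (c2 : w' * (v - w) = v * (v + w))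
    (k1 : F = 2 * b * u * w + 2 * g * v * vm)
    (k2 : F' = 2 * b' * u' * w' + 2 * g' * vp * v) (k3 : F' = F + A * v) :
    (!![0, 0; -(1 / v), 0] : Matrix (Fin 2) (Fin 2) ℂ) =
      ((-(1 / (1 + l))) • ((-b') • !![u', u' * w'; 1, w']) +
        (1 / (1 - l)) • ((-g') • !![vp, vp * v; 1, v]) +
        (1 / l) • !![-A / 4, -F' / 2; 0, A / 4]) * !![1, -v; -(l / v), 1] -
      !![1, -v; -(l / v), 1] * ((-(1 / (1 + l))) • ((-b) • !![u, u * w; 1, w]) +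
        (1 / (1 - l)) • ((-g) • !![v, v * vm; 1, vm]) +
        (1 / l) • !![-A / 4, -F / 2; 0, A / 4]) := by
  have h1 : u + v ≠ 0 := by
    intro h
    rw [h, mul_zero, eq_comm, mul_eq_zero] at c1
    rcases c1 with c | c
    · exact hv c
    · exact hv (by linear_combination (h - c) / 2)
  have h2 : v - w ≠ 0 := by
    intro h
    rw [h, mul_zero, eq_comm, mul_eq_zero] at c2
    rcases c2 with c | c
    · exact hv c
    · exact hv (by linear_combination (h + c) / 2)
  have e1 : u' = v * (u - v) / (u + v) := by field_simp; exact c1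
  have e2 : w' = v * (v + w) / (v - w) := by field_simp; exact c2
  have e3 : u' + w' = 2 * v ^ 2 * (u + w) / ((u + v) * (v - w)) := by
    rw [e1, e2]; field_simp; ring
  have e4 : b' = b * (u + v) * (v - w) / (2 * v ^ 2) := by
    apply mul_right_cancel₀ hs'
    rw [hb', ← hb, e3]; field_simp
  have e5 : b' * u' * w' = b * (u - v) * (v + w) / 2 := by
    rw [e4, e1, e2]; field_simp
  obtain ⟨x, hx⟩ : ∃ x, x = g * v := ⟨_, rfl⟩
  obtain ⟨y, hy⟩ : ∃ y, y = g * vm := ⟨_, rfl⟩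
  obtain ⟨t, ht⟩ : ∃ t, t = g' * v := ⟨_, rfl⟩
  have hz : g' * vp = x + y + 1 - t := by
    rw [hx, hy, ht]; linear_combination hg' - hg
  have hF : F = 2 * b * u * w + 2 * v * y := by rw [hy]; linear_combination k1
  have hF' : F' = b * (u - v) * (v + w) + 2 * v * (x + y + 1 - t) := by
    rw [← hz]; linear_combination k2 + 2 * e5
  have hA : A = (b * (u * v - u * w - v ^ 2 - v * w) + 2 * v * (x + 1 - t)) / v := by
    rw [eq_div_iff hv]; linear_combination hF' - hF - k3
  have eC' : (-g') • !![vp, vp * v; 1, v] =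
      !![-(x + y + 1 - t), -(x + y + 1 - t) * v; -(t / v), -t] := by
    rw [← hz, ht]
    ext i j; fin_cases i <;> fin_cases j <;> simp <;> field_simp
  have eC : (-g) • !![v, v * vm; 1, vm] = !![-x, -(v * y); -(x / v), -y] := by
    rw [hx, hy]
    ext i j; fin_cases i <;> fin_cases j <;> simp <;> field_simp
  rw [eC', eC, hF, hF', hA, e4, e1, e2]
  ext i j
  fin_cases i <;> fin_cases j <;> simp [Matrix.mul_apply, Fin.sum_univ_two] <;>
    field_simp <;> ring

/-- Isomonodromy relation for `V`: for all `n, m ≥ 1` and `λ ∉ {-1, 0, 1}`,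
`dV_{n,m}/dλ = [[0,0],[-1/v_{n,m},0]] = A_{n,m+1}(λ) V_{n,m}(λ) - V_{n,m}(λ) A_{n,m}(λ)`. -/
theorem lax_V_lambda_equation (a : ℝ) (ha : 0 < a) (ha2 : a < 2) (f : ℕ × ℕ → ℂ)
    (hcr : CrossRatioAll f) (hcon : ConstraintAll a f) (hnd : NondegenerateAll f) :
    ∀ n m : ℕ, 1 ≤ n → 1 ≤ m → ∀ l : ℂ, l ≠ -1 → l ≠ 0 → l ≠ 1 →
      (!![0, 0; -(1 / vDiff f n m), 0] : Matrix (Fin 2) (Fin 2) ℂ) =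
        Acoef a f n (m + 1) l * LaxV f n m l - LaxV f n m l * Acoef a f n m l := by
  intro n m hn hm l h1 h0 h2
  obtain ⟨n, rfl⟩ : ∃ k, n = k + 1 := ⟨n - 1, by omega⟩
  obtain ⟨m, rfl⟩ : ∃ k, m = k + 1 := ⟨m - 1, by omega⟩
  obtain ⟨hd, -, hs⟩ := hnd
  obtain ⟨hc, -⟩ := hcon
  have hl1 : 1 + l ≠ 0 := fun h => h1 (by linear_combination h)
  have hl2 : 1 - l ≠ 0 := fun h => h2 (by linear_combination -h)
  have su := (hs n (m + 1)).1
  have su' := (hs n (m + 2)).1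
  have sv := (hs (n + 1) m).2
  have sv' := (hs (n + 1) (m + 1)).2
  have k1 := (hc n m).2.2
  have k2 := (hc n (m + 1)).2.2
  have d1 : f (n + 2, m + 1) - f (n, m + 1) =
      uDiff f (n + 1) (m + 1) + uDiff f n (m + 1) := by simp only [uDiff]; ring
  have d2 : f (n + 2, m + 2) - f (n, m + 2) =
      uDiff f (n + 1) (m + 2) + uDiff f n (m + 2) := by simp only [uDiff]; ring
  have d3 : f (n + 1, m + 2) - f (n + 1, m) =
      vDiff f (n + 1) (m + 1) + vDiff f (n + 1) m := by simp only [vDiff]; ring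
  have d4 : f (n + 1, m + 3) - f (n + 1, m + 1) =
      vDiff f (n + 1) (m + 2) + vDiff f (n + 1) (m + 1) := by simp only [vDiff]; ring
  have q1 := (hcr (n + 1) (m + 1)).2.2.2.2
  have q2 := (hcr n (m + 1)).2.2.2.2
  simp only [add_assoc, Nat.reduceAdd] at k1 k2 q1 q2
  rw [d1, d3] at k1
  rw [d2, d4] at k2
  have key := lax_aux (a : ℂ) (a * f (n + 1, m + 1)) (a * f (n + 1, m + 2))
    (((n + 1 : ℕ) : ℂ) / (uDiff f (n + 1) (m + 1) + uDiff f n (m + 1)))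
    (((n + 1 : ℕ) : ℂ) / (uDiff f (n + 1) (m + 2) + uDiff f n (m + 2)))
    (((m + 1 : ℕ) : ℂ) / (vDiff f (n + 1) (m + 1) + vDiff f (n + 1) m))
    (((m + 2 : ℕ) : ℂ) / (vDiff f (n + 1) (m + 2) + vDiff f (n + 1) (m + 1)))
    (uDiff f (n + 1) (m + 1)) (uDiff f n (m + 1))
    (uDiff f (n + 1) (m + 2)) (uDiff f n (m + 2))
    (vDiff f (n + 1) (m + 1)) (vDiff f (n + 1) m) (vDiff f (n + 1) (m + 2))
    ((n + 1 : ℕ) : ℂ) ((m + 1 : ℕ) : ℂ) l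
    (hd _ _).1 (hd _ _).1 (hd _ _).2 hl1 h0 hl2 su su'
    (div_mul_cancel₀ _ su) (div_mul_cancel₀ _ su') (div_mul_cancel₀ _ sv)
    (by rw [div_mul_cancel₀ _ sv']; push_cast; ring)
    (by simp only [uDiff, vDiff, add_assoc, Nat.reduceAdd]; linear_combination -q1)
    (by simp only [uDiff, vDiff, add_assoc, Nat.reduceAdd]; linear_combination q2)
    (by rw [k1]; simp only [uDiff, vDiff, add_assoc, Nat.reduceAdd]; push_cast; ring)
    (by rw [k2]; simp only [uDiff, vDiff, add_assoc, Nat.reduceAdd]; push_cast; ring)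
    (by simp only [vDiff, add_assoc, Nat.reduceAdd]; ring)
  have eD : ∀ z : ℂ, -((a : ℂ) / 2) * z = -(a * z) / 2 := fun z => by ring
  simp only [Acoef, Bres, Cres, Dres, LaxV, eD, Nat.add_sub_cancel, neg_div, add_assoc,
    Nat.reduceAdd, Nat.add_succ_sub_one] at key ⊢
  exact key
end

section
/- Let 0 < a < 2, let n, m ≥ 1 be integers with n + m even, and let s be an integer with 0 ≤ s ≤ n + m − 1. Then the integral H_s = ∫₀^∞ 2·sin(aπ/2)·e^{iaπ/4}·t^{−a/2}·(−it)^s·(−it − 1)^{−m}·(−it + 1)^{−n} dt converges absolutely and equals H_s = 2πi·e^{iaπ/2}·[ (1/(m−1)!)·D₁ + (1/(n−1)!)·D₂ ], where D₁ is the (m−1)-st derivative at λ = 1 of the function λ ↦ λ^{s−a/2}·(λ+1)^{−n} (with λ^{s−a/2} the principal branch, analytic near λ = 1), and D₂ is the (n−1)-st derivative at λ = −1 of the function λ ↦ exp((s − a/2)·(Log(−λ) + iπ))·(λ−1)^{−m} (Log being the principal complex logarithm, so that this is λ^{s−a/2} in the branch with arg λ ∈ (−π/2, 3π/2), analytic near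 λ = −1). -/
open MeasureTheory

namespace MR
open Complex Set Filter Topology

lemma int_base {α : ℝ} (h0 : 0 < α) (h1 : α < 1) :
    IntegrableOn (fun t : ℝ => t ^ (-α) * (1 + t)⁻¹) (Ioi 0) := by
  rw [← Ioc_union_Ioi_eq_Ioi (zero_le_one' ℝ)]
  have hm : Measurable (fun t : ℝ => t ^ (-α) * (1 + t)⁻¹) := by fun_prop
  refine IntegrableOn.union ?_ ?_
  · have h : IntegrableOn (fun t : ℝ => t ^ (-α)) (Ioc 0 1) := by
      rw [← intervalIntegrable_iff_integrableOn_Ioc_of_le zero_le_one]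
      exact intervalIntegral.intervalIntegrable_rpow' (by linarith)
    refine Integrable.mono' h hm.aestronglyMeasurable ?_
    refine (ae_restrict_iff' measurableSet_Ioc).2 (Eventually.of_forall fun t ht => ?_)
    have : 0 ≤ t ^ (-α) := Real.rpow_nonneg ht.1.le _
    rw [Real.norm_of_nonneg (mul_nonneg this (inv_nonneg.2 (by linarith [ht.1])))]
    exact mul_le_of_le_one_right this (inv_le_one_of_one_le₀ (by linarith [ht.1]))
  · have h : IntegrableOn (fun t : ℝ => t ^ (-α - 1)) (Ioi 1) :=
      integrableOn_Ioi_rpow_of_lt (by linarith) zero_lt_one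
    refine Integrable.mono' h hm.aestronglyMeasurable ?_
    refine (ae_restrict_iff' measurableSet_Ioi).2 (Eventually.of_forall fun t ht => ?_)
    have ht : (1 : ℝ) < t := ht
    have : 0 ≤ t ^ (-α) := Real.rpow_nonneg (by linarith) _
    rw [Real.norm_of_nonneg (mul_nonneg this (inv_nonneg.2 (by linarith))),
      Real.rpow_sub_one (by linarith), div_eq_mul_inv]
    gcongr
    linarith

lemma lower {z₀ : ℂ} (hz : z₀ ∈ slitPlane) : ∃ δ > 0, ∃ C > 0, ∀ z ∈ Metric.ball z₀ δ,
    ∀ t : ℝ, 0 ≤ t → (1 + t) ≤ C * ‖(t : ℂ) + z‖ := by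
  obtain ⟨d, hd, hb⟩ := Metric.isOpen_iff.1 isOpen_slitPlane z₀ hz
  refine ⟨d / 2, by positivity, (1 + (‖z₀‖ + d / 2)) * (2 / d) + 1, by positivity, ?_⟩
  intro z hz t ht
  rw [Metric.mem_ball, dist_eq_norm] at hz
  have h1 : d / 2 ≤ ‖(t : ℂ) + z‖ := by
    by_contra! h
    have : (-t : ℂ) ∈ Metric.ball z₀ d := by
      rw [Metric.mem_ball, dist_eq_norm]
      calc ‖-(t : ℂ) - z₀‖ = ‖(z - z₀) - (t + z)‖ := by congr 1; ring
        _ ≤ _ := norm_sub_le _ _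
        _ < d := by linarith
    have := hb this
    rw [← ofReal_neg, ofReal_mem_slitPlane] at this
    linarith
  have h2 : t ≤ ‖(t : ℂ) + z‖ + (‖z₀‖ + d / 2) := by
    calc t = ‖(t : ℂ)‖ := by simp [abs_of_nonneg ht]
      _ = ‖((t : ℂ) + z) - (z - z₀) - z₀‖ := by congr 1; ring
      _ ≤ ‖((t : ℂ) + z) - (z - z₀)‖ + ‖z₀‖ := norm_sub_le _ _
      _ ≤ (‖(t : ℂ) + z‖ + ‖z - z₀‖) + ‖z₀‖ := by gcongr; exact norm_sub_le _ _
      _ ≤ _ := by linarith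
  have h3 : 1 ≤ (2 / d) * ‖(t : ℂ) + z‖ := by
    rw [div_mul_eq_mul_div, le_div_iff₀ hd]; linarith
  have h4 : 0 ≤ 1 + (‖z₀‖ + d / 2) := by positivity
  nlinarith [mul_le_mul_of_nonneg_left h3 h4]

noncomputable def gk (α : ℝ) (k : ℕ) (z : ℂ) (t : ℝ) : ℂ := ((t ^ (-α) : ℝ) : ℂ) * (((t : ℂ) + z) ^ k)⁻¹

lemma gk_meas (α : ℝ) (k : ℕ) (z : ℂ) : Measurable (gk α k z) := by
  unfold gk
  fun_prop

lemma gk_bound {α C : ℝ} {k : ℕ} {z : ℂ} {t : ℝ} (ht : 0 < t) (hC : 0 < C)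
    (h : (1 + t) ≤ C * ‖(t : ℂ) + z‖) :
    ‖gk α (k + 1) z t‖ ≤ C ^ (k + 1) * (t ^ (-α) * (1 + t)⁻¹) := by
  have h0 : 0 ≤ t ^ (-α) := Real.rpow_nonneg ht.le _
  have hp : 0 < ‖(t : ℂ) + z‖ := by
    by_contra! h'
    nlinarith
  have h1 : (‖(t : ℂ) + z‖ ^ (k + 1))⁻¹ ≤ C ^ (k + 1) * (1 + t)⁻¹ := by
    rw [← div_eq_mul_inv, le_div_iff₀ (by linarith), inv_mul_le_iff₀ (by positivity), ← mul_pow,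
      mul_comm _ C]
    calc 1 + t ≤ (1 + t) ^ (k + 1) := le_self_pow₀ (by linarith) (by simp)
      _ ≤ _ := by gcongr
  rw [gk, norm_mul, norm_inv, norm_pow, norm_real, Real.norm_of_nonneg h0]
  calc _ ≤ t ^ (-α) * (C ^ (k + 1) * (1 + t)⁻¹) := by gcongr
    _ = _ := by ring

lemma gk_int {α : ℝ} (h0 : 0 < α) (h1 : α < 1) (k : ℕ) {z : ℂ} (hz : z ∈ slitPlane) :
    IntegrableOn (gk α (k + 1) z) (Ioi 0) := by
  obtain ⟨δ, hδ, C, hC, h⟩ := lower hz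
  refine Integrable.mono' ((int_base h0 h1).const_mul (C ^ (k + 1)))
    (gk_meas _ _ _).aestronglyMeasurable ?_
  refine (ae_restrict_iff' measurableSet_Ioi).2 (Eventually.of_forall fun t ht => ?_)
  exact gk_bound ht hC (h z (Metric.mem_ball_self hδ) t (le_of_lt ht))

lemma gk_deriv {α : ℝ} (h0 : 0 < α) (h1 : α < 1) (k : ℕ) {z : ℂ} (hz : z ∈ slitPlane) :
    HasDerivAt (fun z => ∫ t in Ioi (0 : ℝ), gk α (k + 1) z t)
      (-(k + 1) * ∫ t in Ioi (0 : ℝ), gk α (k + 2) z t) z := by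
  obtain ⟨δ, hδ, C, hC, h⟩ := lower hz
  rw [← integral_const_mul]
  refine (hasDerivAt_integral_of_dominated_loc_of_deriv_le (μ := volume.restrict (Ioi (0 : ℝ)))
    (F := fun z t => gk α (k + 1) z t) (F' := fun z t => -(k + 1) * gk α (k + 2) z t)
    (bound := fun t => ‖(-(k + 1) : ℂ)‖ * (C ^ (k + 2) * (t ^ (-α) * (1 + t)⁻¹)))
    (Metric.ball_mem_nhds z hδ)
    (Eventually.of_forall fun z => (gk_meas _ _ _).aestronglyMeasurable) (gk_int h0 h1 k hz)
    ((gk_meas _ _ _).const_mul _).aestronglyMeasurable ?_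
    (((int_base h0 h1).const_mul _).const_mul _) ?_).2
  · refine (ae_restrict_iff' measurableSet_Ioi).2 (Eventually.of_forall fun t ht => ?_)
    intro w hw
    rw [norm_mul]
    gcongr
    exact gk_bound ht hC (h w hw t (le_of_lt ht))
  · refine (ae_restrict_iff' measurableSet_Ioi).2 (Eventually.of_forall fun t ht => ?_)
    intro w hw
    have hne : (t : ℂ) + w ≠ 0 := by
      intro h'
      have := h w hw t (le_of_lt ht)
      have ht : (0 : ℝ) < t := ht
      rw [h', norm_zero] at this
      linarith
    unfold gk
    have h2 := ((((hasDerivAt_id w).const_add (t : ℂ)).pow (k + 1)).inv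
      (pow_ne_zero _ hne)).const_mul ((t ^ (-α) : ℝ) : ℂ)
    convert! h2 using 1
    simp only [id, Pi.pow_apply]
    push_cast
    field_simp
    ring

lemma F_one {α : ℝ} (h0 : 0 < α) (h1 : α < 1) :
    ∫ t in Ioi (0 : ℝ), gk α 1 1 t = (Real.pi : ℂ) / sin ((Real.pi : ℂ) * α) := by
  rw [← Complex.Gamma_mul_Gamma_one_sub, Gamma_mul_Gamma_eq_betaIntegral (by simpa) (by simpa)]
  simp only [add_sub_cancel, Complex.Gamma_one, one_mul, betaIntegral]
  rw [intervalIntegral.integral_of_le zero_le_one, integral_Ioc_eq_integral_Ioo]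
  have himg : (fun t : ℝ => (1 + t)⁻¹) '' Ioi 0 = Ioo 0 1 := by
    ext x
    constructor
    · rintro ⟨t, ht, rfl⟩
      have ht : (0 : ℝ) < t := ht
      exact ⟨by positivity, inv_lt_one_of_one_lt₀ (by linarith)⟩
    · rintro ⟨hx0, hx1⟩
      refine ⟨x⁻¹ - 1, ?_, by simp⟩
      simpa using (one_lt_inv₀ hx0).2 hx1
  rw [← himg, integral_image_eq_integral_abs_deriv_smul (f' := fun t : ℝ => -1 / (1 + t) ^ 2)
    measurableSet_Ioi]
  · refine setIntegral_congr_fun measurableSet_Ioi fun t ht => ?_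
    have ht : (0 : ℝ) < t := ht
    have hp : 0 < 1 + t := by linarith
    have e1 : (1 : ℂ) - (((1 + t)⁻¹ : ℝ) : ℂ) = ((t / (1 + t) : ℝ) : ℂ) := by
      rw [← ofReal_one, ← ofReal_sub]; congr 1; field_simp; ring
    have e2 : (α : ℂ) - 1 = ((α - 1 : ℝ) : ℂ) := by simp
    have e3 : (1 : ℂ) - α - 1 = ((-α : ℝ) : ℂ) := by simp
    have e4 : |-1 / (1 + t) ^ 2| = ((1 + t) ^ 2)⁻¹ := by
      rw [neg_div, abs_neg, abs_of_pos (by positivity), one_div]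
    rw [e1, e2, e3, e4, ← ofReal_cpow (by positivity), ← ofReal_cpow (by positivity), real_smul,
      ← ofReal_mul, ← ofReal_mul, gk, pow_one, ← ofReal_one, ← ofReal_add, ← ofReal_inv,
      ← ofReal_mul]
    congr 1
    rw [Real.div_rpow ht.le hp.le, Real.inv_rpow hp.le, Real.rpow_sub_one hp.ne', Real.rpow_neg hp.le α]
    have : 0 < (1 + t) ^ α := Real.rpow_pos_of_pos hp _
    field_simp
    ring
  · intro t ht
    have ht : (0 : ℝ) < t := ht
    have := (((hasDerivAt_id t).const_add 1).inv (by simp only [id]; linarith : 1 + id t ≠ 0))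
    exact this.hasDerivWithinAt
  · intro x _ y _ h
    simpa using h

lemma F_real {α : ℝ} (h0 : 0 < α) (h1 : α < 1) {x : ℝ} (hx : 0 < x) :
    ∫ t in Ioi (0 : ℝ), gk α 1 x t = (Real.pi : ℂ) / sin ((Real.pi : ℂ) * α) * (x : ℂ) ^ (-α : ℂ) := by
  have := integral_comp_mul_left_Ioi' (gk α 1 x) 0 hx
  rw [mul_zero] at this
  rw [← this, ← F_one h0 h1, real_smul, ← integral_const_mul, ← integral_mul_const]
  refine setIntegral_congr_fun measurableSet_Ioi fun t ht => ?_
  have ht : (0 : ℝ) < t := ht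
  have hc : (x : ℂ) ≠ 0 := by exact_mod_cast hx.ne'
  have hd : (t : ℂ) + 1 ≠ 0 := by exact_mod_cast (by linarith : t + 1 ≠ 0)
  have e : (x : ℂ) ^ (-α : ℂ) = ((x ^ (-α) : ℝ) : ℂ) := by
    rw [ofReal_cpow hx.le]; simp
  simp only [gk, pow_one]
  rw [e, Real.mul_rpow hx.le ht.le]
  have e5 : ((x * t : ℝ) : ℂ) + x = x * (t + 1) := by push_cast; ring
  rw [e5]
  push_cast
  field_simp

lemma F_slit {α : ℝ} (h0 : 0 < α) (h1 : α < 1) {z : ℂ} (hz : z ∈ slitPlane) :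
    ∫ t in Ioi (0 : ℝ), gk α 1 z t = (Real.pi : ℂ) / sin ((Real.pi : ℂ) * α) * z ^ (-α : ℂ) := by
  have hA : AnalyticOnNhd ℂ (fun z => ∫ t in Ioi (0 : ℝ), gk α 1 z t) slitPlane :=
    DifferentiableOn.analyticOnNhd
      (fun w hw => (gk_deriv h0 h1 0 hw).differentiableAt.differentiableWithinAt) isOpen_slitPlane
  have hB : AnalyticOnNhd ℂ (fun z : ℂ => (Real.pi : ℂ) / sin ((Real.pi : ℂ) * α) * z ^ (-α : ℂ)) slitPlane := by
    refine DifferentiableOn.analyticOnNhd (fun w hw => ?_) isOpen_slitPlane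
    exact ((differentiableAt_id.cpow_const hw).const_mul _).differentiableWithinAt
  have hpc : IsPreconnected slitPlane :=
    (starConvex_one_slitPlane.isPathConnected one_mem_slitPlane).isConnected.isPreconnected
  refine hA.eqOn_of_preconnected_of_frequently_eq hB hpc one_mem_slitPlane ?_ hz
  have ht : Tendsto (fun x : ℝ => (x : ℂ)) (𝓝[≠] 1) (𝓝[≠] 1) := by
    refine tendsto_nhdsWithin_of_tendsto_nhds_of_eventually_within _ ?_ ?_
    · exact (continuous_ofReal.tendsto' 1 1 (by simp)).mono_left nhdsWithin_le_nhds
    · filter_upwards [self_mem_nhdsWithin] with x hx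
      simpa using hx
  refine ht.frequently (Eventually.frequently ?_)
  have : ∀ᶠ x : ℝ in 𝓝[≠] 1, 0 < x := nhdsWithin_le_nhds (lt_mem_nhds one_pos)
  filter_upwards [this] with x hx
  exact F_real h0 h1 hx


noncomputable def BB (α : ℝ) (c : ℂ) : ℂ := exp (-(I * (Real.pi : ℂ) * α / 2)) * (-I * c) ^ (-α : ℂ)

noncomputable def KK (α : ℝ) : ℂ := 2 * sin ((Real.pi : ℂ) * α) * exp (-(I * (Real.pi : ℂ) * α / 2))

noncomputable def bb (α : ℝ) (k : ℕ) (c : ℂ) : ℂ :=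
  KK α * I ^ k * ∫ t in Ioi (0 : ℝ), gk α k (-I * c) t

def UU : Set ℂ := {c | -I * c ∈ slitPlane}

lemma UU_open : IsOpen UU := isOpen_slitPlane.preimage (by fun_prop)

lemma mem_UU_of_re {c : ℂ} (h : c.re ≠ 0) : c ∈ UU := by
  right
  simpa using h

lemma re_pos_of_closedBall {z : ℂ} (hz : z ∈ Metric.closedBall (1 : ℂ) (1 / 2)) : 0 < z.re := by
  rw [Metric.mem_closedBall, dist_eq_norm] at hz
  have := (abs_le.1 ((abs_re_le_norm _).trans hz)).1
  simp at this
  linarith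

lemma re_neg_of_closedBall {z : ℂ} (hz : z ∈ Metric.closedBall (-1 : ℂ) (1 / 2)) : z.re < 0 := by
  rw [Metric.mem_closedBall, dist_eq_norm] at hz
  have := (abs_le.1 ((abs_re_le_norm _).trans hz)).2
  simp at this
  linarith

lemma BB_diff (α : ℝ) {c : ℂ} (h : c ∈ UU) : DifferentiableAt ℂ (BB α) c := by
  unfold BB
  exact ((by fun_prop : DifferentiableAt ℂ (fun c : ℂ => -I * c) c).cpow_const h).const_mul _

lemma sin_ne {α : ℝ} (h0 : 0 < α) (h1 : α < 1) : sin ((Real.pi : ℂ) * α) ≠ 0 := by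
  rw [← ofReal_mul, ← ofReal_sin]
  refine ofReal_ne_zero.2 (Real.sin_pos_of_pos_of_lt_pi (by positivity) ?_).ne'
  nlinarith [Real.pi_pos]

lemma bb_one {α : ℝ} (h0 : 0 < α) (h1 : α < 1) {c : ℂ} (hc : c ∈ UU) :
    bb α 1 c = 2 * Real.pi * I * BB α c := by
  rw [bb, F_slit h0 h1 hc, KK, BB]
  have := sin_ne h0 h1
  field_simp

lemma bb_deriv {α : ℝ} (h0 : 0 < α) (h1 : α < 1) (k : ℕ) {c : ℂ} (hc : c ∈ UU) :
    HasDerivAt (bb α (k + 1)) ((k + 1) * bb α (k + 2) c) c := by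
  have h := (HasDerivAt.comp c (gk_deriv h0 h1 k hc)
    ((hasDerivAt_id c).const_mul (-I))).const_mul (KK α * I ^ (k + 1))
  convert! h using 1
  rw [bb]
  ring

lemma bb_iter {α : ℝ} (h0 : 0 < α) (h1 : α < 1) (k : ℕ) : ∀ {c : ℂ}, c ∈ UU →
    iteratedDeriv k (bb α 1) c = k.factorial * bb α (k + 1) c := by
  induction k with
  | zero => intro c _; simp
  | succ k ih =>
    intro c hc
    have : iteratedDeriv k (bb α 1) =ᶠ[𝓝 c] fun c => k.factorial * bb α (k + 1) c := by
      filter_upwards [UU_open.mem_nhds hc] with w hw using ih hw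
    rw [iteratedDeriv_succ, this.deriv_eq, ((bb_deriv h0 h1 k hc).const_mul _).deriv,
      Nat.factorial_succ]
    push_cast
    ring

lemma ker_eq {α : ℝ} (k : ℕ) (c : ℂ) (t : ℝ) :
    ((t ^ (-α) : ℝ) : ℂ) * ((-I * t - c) ^ k)⁻¹ = I ^ k * gk α k (-I * c) t := by
  have : (-I * t - c) = I⁻¹ * (t + -I * c) := by
    rw [inv_I]; ring_nf; simp; ring
  rw [this, gk, mul_pow, mul_inv, inv_pow, inv_inv]
  ring

lemma key {α : ℝ} (h0 : 0 < α) (h1 : α < 1) (k : ℕ) {c : ℂ}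
    (hc : Metric.closedBall c (1 / 2) ⊆ UU) :
    IntegrableOn (fun t : ℝ => ((t ^ (-α) : ℝ) : ℂ) * ((-I * t - c) ^ (k + 1))⁻¹) (Ioi 0) ∧
    KK α * ∫ t in Ioi (0 : ℝ), ((t ^ (-α) : ℝ) : ℂ) * ((-I * t - c) ^ (k + 1))⁻¹ =
      ∮ z in C(c, 1 / 2), BB α z * ((z - c) ^ (k + 1))⁻¹ := by
  have hcU : c ∈ UU := hc (Metric.mem_closedBall_self (by norm_num))
  simp only [ker_eq]
  refine ⟨(gk_int h0 h1 k hcU).const_mul _, ?_⟩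
  have hd : DifferentiableOn ℂ (BB α) (Metric.closedBall c (1 / 2)) :=
    fun z hz => (BB_diff α (hc hz)).differentiableWithinAt
  have h2 := hd.circleIntegral_one_div_sub_center_pow_smul (by norm_num) k
  have h3 : ∮ z in C(c, 1 / 2), BB α z * ((z - c) ^ (k + 1))⁻¹ =
      ∮ z in C(c, 1 / 2), (1 / (z - c) ^ (k + 1)) • BB α z := by
    congr 1; ext z; rw [smul_eq_mul, one_div, mul_comm]
  rw [h3, h2, integral_const_mul, ← mul_assoc]
  change bb α (k + 1) c = _
  have h4 : bb α 1 =ᶠ[𝓝 c] fun c => 2 * Real.pi * I * BB α c := by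
    filter_upwards [UU_open.mem_nhds hcU] with w hw using bb_one h0 h1 hw
  have h5 := bb_iter h0 h1 k hcU
  rw [h4.iteratedDeriv_eq, iteratedDeriv_const_mul_field] at h5
  have : (k.factorial : ℂ) ≠ 0 := by exact_mod_cast k.factorial_ne_zero
  rw [smul_eq_mul, div_mul_eq_mul_div, h5]
  field_simp

def Good (α : ℝ) (r : ℂ → ℂ) : Prop :=
  IntegrableOn (fun t : ℝ => ((t ^ (-α) : ℝ) : ℂ) * r (-I * t)) (Ioi 0) ∧
  CircleIntegrable (fun z => BB α z * r z) 1 (1 / 2) ∧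
  CircleIntegrable (fun z => BB α z * r z) (-1) (1 / 2) ∧
  KK α * ∫ t in Ioi (0 : ℝ), ((t ^ (-α) : ℝ) : ℂ) * r (-I * t) =
    (∮ z in C(1, 1 / 2), BB α z * r z) + ∮ z in C(-1, 1 / 2), BB α z * r z

lemma sphere_ne_one {z : ℂ} (h : z ∈ Metric.sphere (1 : ℂ) (1 / 2)) : z ≠ 1 ∧ z ≠ -1 := by
  have hre := re_pos_of_closedBall (Metric.sphere_subset_closedBall h)
  constructor
  · rintro rfl; simp at h
  · rintro rfl; simp at hre; linarith

lemma sphere_ne_neg_one {z : ℂ} (h : z ∈ Metric.sphere (-1 : ℂ) (1 / 2)) : z ≠ 1 ∧ z ≠ -1 := by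
  have hre := re_neg_of_closedBall (Metric.sphere_subset_closedBall h)
  constructor
  · rintro rfl; simp at hre; linarith
  · rintro rfl; simp at h

lemma ray_ne (t : ℝ) : -I * (t : ℂ) ≠ 1 ∧ -I * (t : ℂ) ≠ -1 := by
  constructor <;> intro h <;> simpa using congrArg re h

lemma Good.lin {α : ℝ} {r r' R : ℂ → ℂ} (h : Good α r) (h' : Good α r') (x y : ℂ)
    (hR : ∀ z : ℂ, z ≠ 1 → z ≠ -1 → R z = x * r z + y * r' z) : Good α R := by
  obtain ⟨a1, a2, a3, a4⟩ := h
  obtain ⟨b1, b2, b3, b4⟩ := h'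
  have e1 : (fun t : ℝ => ((t ^ (-α) : ℝ) : ℂ) * R (-I * t)) = fun t : ℝ =>
      x * (((t ^ (-α) : ℝ) : ℂ) * r (-I * t)) + y * (((t ^ (-α) : ℝ) : ℂ) * r' (-I * t)) := by
    ext t
    rw [hR _ (ray_ne t).1 (ray_ne t).2]
    ring
  have e2 : ∀ z ∈ Metric.sphere (1 : ℂ) (1 / 2), BB α z * R z =
      x • (BB α z * r z) + y • (BB α z * r' z) := by
    intro z hz
    rw [hR z (sphere_ne_one hz).1 (sphere_ne_one hz).2, smul_eq_mul, smul_eq_mul]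
    ring
  have e3 : ∀ z ∈ Metric.sphere (-1 : ℂ) (1 / 2), BB α z * R z =
      x • (BB α z * r z) + y • (BB α z * r' z) := by
    intro z hz
    rw [hR z (sphere_ne_neg_one hz).1 (sphere_ne_neg_one hz).2, smul_eq_mul, smul_eq_mul]
    ring
  have c2 := (a2.const_fun_smul (a := x)).add (b2.const_fun_smul (a := y))
  have c3 := (a3.const_fun_smul (a := x)).add (b3.const_fun_smul (a := y))
  have hhalf : (0 : ℝ) ≤ 1 / 2 := by norm_num
  refine ⟨?_, ?_, ?_, ?_⟩
  · rw [e1]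
    exact (a1.const_mul x).add (b1.const_mul y)
  · refine (circleIntegrable_congr ?_).2 c2
    rw [abs_of_nonneg hhalf]
    exact fun z hz => e2 z hz
  · refine (circleIntegrable_congr ?_).2 c3
    rw [abs_of_nonneg hhalf]
    exact fun z hz => e3 z hz
  · rw [e1, circleIntegral.integral_congr hhalf e2, circleIntegral.integral_congr hhalf e3,
      circleIntegral.integral_add (a2.const_fun_smul (a := x)) (b2.const_fun_smul (a := y)),
      circleIntegral.integral_add (a3.const_fun_smul (a := x)) (b3.const_fun_smul (a := y)),
      integral_add (a1.const_mul x) (b1.const_mul y), integral_const_mul, integral_const_mul]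
    rw [circleIntegral.integral_smul, circleIntegral.integral_smul, circleIntegral.integral_smul,
      circleIntegral.integral_smul]
    simp only [smul_eq_mul]
    linear_combination x * a4 + y * b4

lemma Good.congr {α : ℝ} {r R : ℂ → ℂ} (h : Good α r)
    (hR : ∀ z : ℂ, z ≠ 1 → z ≠ -1 → R z = r z) : Good α R :=
  h.lin h 1 0 fun z h1 h2 => by rw [hR z h1 h2]; ring

lemma ball1 : Metric.closedBall (1 : ℂ) (1 / 2) ⊆ UU :=
  fun _ hz => mem_UU_of_re (re_pos_of_closedBall hz).ne'

lemma ball2 : Metric.closedBall (-1 : ℂ) (1 / 2) ⊆ UU :=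
  fun _ hz => mem_UU_of_re (re_neg_of_closedBall hz).ne

lemma circ_int (α : ℝ) {r : ℂ → ℂ} {c : ℂ} (hc : Metric.closedBall c (1 / 2) ⊆ UU)
    (hr : ∀ z ∈ Metric.sphere c (1 / 2), ContinuousAt r z) :
    CircleIntegrable (fun z => BB α z * r z) c (1 / 2) := by
  refine ContinuousOn.circleIntegrable (by norm_num) fun z hz => ?_
  exact ((BB_diff α (hc (Metric.sphere_subset_closedBall hz))).continuousAt.mul
    (hr z hz)).continuousWithinAt

lemma circ_zero (α : ℝ) {r : ℂ → ℂ} {c : ℂ} (hc : Metric.closedBall c (1 / 2) ⊆ UU)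
    (hr : ∀ z ∈ Metric.closedBall c (1 / 2), DifferentiableAt ℂ r z) :
    ∮ z in C(c, 1 / 2), BB α z * r z = 0 := by
  refine circleIntegral_eq_zero_of_differentiable_on_off_countable (by norm_num)
    countable_empty ?_ ?_
  · intro z hz
    exact ((BB_diff α (hc hz)).mul (hr z hz)).continuousAt.continuousWithinAt
  · intro z hz
    have hz := Metric.ball_subset_closedBall hz.1
    exact (BB_diff α (hc hz)).mul (hr z hz)

lemma pow_inv_diff (k : ℕ) {c z : ℂ} (h : z ≠ c) :
    DifferentiableAt ℂ (fun z : ℂ => ((z - c) ^ k)⁻¹) z :=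
  DifferentiableAt.fun_inv (by fun_prop) (pow_ne_zero _ (sub_ne_zero.2 h))

lemma good_one {α : ℝ} (h0 : 0 < α) (h1 : α < 1) (k : ℕ) :
    Good α (fun z => ((z - 1) ^ (k + 1))⁻¹) := by
  obtain ⟨h2, h3⟩ := key h0 h1 k ball1
  refine ⟨h2, circ_int α ball1 ?_, circ_int α ball2 ?_, ?_⟩
  · exact fun z hz => (pow_inv_diff _ (sphere_ne_one hz).1).continuousAt
  · exact fun z hz => (pow_inv_diff _ (sphere_ne_neg_one hz).1).continuousAt
  · rw [h3, circ_zero α ball2, add_zero]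
    intro z hz
    refine pow_inv_diff _ ?_
    rintro rfl
    have := re_neg_of_closedBall hz
    simp at this
    linarith

lemma good_neg_one {α : ℝ} (h0 : 0 < α) (h1 : α < 1) (k : ℕ) :
    Good α (fun z => ((z - -1) ^ (k + 1))⁻¹) := by
  obtain ⟨h2, h3⟩ := key h0 h1 k ball2
  refine ⟨h2, circ_int α ball1 ?_, circ_int α ball2 ?_, ?_⟩
  · exact fun z hz => (pow_inv_diff _ (sphere_ne_one hz).2).continuousAt
  · exact fun z hz => (pow_inv_diff _ (sphere_ne_neg_one hz).2).continuousAt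
  · rw [h3, circ_zero α ball1, zero_add]
    intro z hz
    refine pow_inv_diff _ ?_
    rintro rfl
    have := re_pos_of_closedBall hz
    simp at this
    linarith

noncomputable def gs (s m n : ℕ) (z : ℂ) : ℂ := z ^ s * ((z - 1) ^ m)⁻¹ * ((z + 1) ^ n)⁻¹

lemma add_one_ne {z : ℂ} (h : z ≠ -1) : z + 1 ≠ 0 := fun h' => h (eq_neg_of_add_eq_zero_left h')

lemma good_gs_zero {α : ℝ} (h0 : 0 < α) (h1 : α < 1) (m n : ℕ) (h : 0 < m + n) :
    Good α (gs 0 m n) := by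
  induction m generalizing n with
  | zero =>
    obtain ⟨n, rfl⟩ : ∃ k, n = k + 1 := ⟨n - 1, by omega⟩
    exact (good_neg_one h0 h1 n).congr fun z _ _ => by simp [gs]
  | succ m ihm =>
    induction n with
    | zero => exact (good_one h0 h1 m).congr fun z _ _ => by simp [gs]
    | succ n ihn =>
      refine (ihn (by omega)).lin (ihm (n + 1) (by omega)) (1 / 2) (-1 / 2) fun z hz1 hz2 => ?_
      have h2 := sub_ne_zero.2 hz1
      have h3 := add_one_ne hz2
      simp only [gs, pow_succ]
      field_simp
      ring

lemma good_gs {α : ℝ} (h0 : 0 < α) (h1 : α < 1) (s m n : ℕ) (h : s < m + n) :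
    Good α (gs s m n) := by
  induction s generalizing m n with
  | zero => exact good_gs_zero h0 h1 m n h
  | succ s ih =>
    rcases m with _ | m
    · obtain ⟨n, rfl⟩ : ∃ k, n = k + 1 := ⟨n - 1, by omega⟩
      refine (ih 0 n (by omega)).lin (ih 0 (n + 1) (by omega)) 1 (-1) fun z hz1 hz2 => ?_
      have h3 := add_one_ne hz2
      simp only [gs, pow_succ]
      field_simp
      ring
    · refine (ih m n (by omega)).lin (ih (m + 1) n (by omega)) 1 1 fun z hz1 hz2 => ?_
      have h2 := sub_ne_zero.2 hz1
      have h3 := add_one_ne hz2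
      simp only [gs, pow_succ]
      field_simp
      ring

lemma BB_pos (α : ℝ) (s : ℕ) {z : ℂ} (hz : 0 < z.re) :
    BB α z * z ^ s = z ^ ((s : ℂ) - α) := by
  have hz0 : z ≠ 0 := by rintro rfl; simp at hz
  have harg := abs_lt.1 (abs_arg_lt_pi_div_two_iff.2 (Or.inl hz))
  have hlog : log (-I * z) = log z - Real.pi / 2 * I := by
    rw [Complex.log_mul (by simp) hz0, log_neg_I]
    · ring
    · rw [arg_neg_I]
      constructor <;> linarith [harg.1, harg.2, Real.pi_pos]
  rw [BB, cpow_sub _ _ hz0, cpow_natCast, cpow_def_of_ne_zero (by simpa using hz0),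
    cpow_def_of_ne_zero hz0, hlog, ← exp_add, div_eq_mul_inv (z ^ s), ← exp_neg, mul_comm]
  congr 2
  ring

lemma BB_neg (α : ℝ) (s : ℕ) {z : ℂ} (hz : z.re < 0) :
    BB α z * z ^ s = exp (((s : ℂ) - α) * (log (-z) + Real.pi * I)) := by
  have hz0 : z ≠ 0 := by rintro rfl; simp at hz
  have hz' : 0 < (-z).re := by simpa using hz
  have harg := abs_lt.1 (abs_arg_lt_pi_div_two_iff.2 (Or.inl hz'))
  have hlog : log (-I * z) = log (-z) + Real.pi / 2 * I := by
    rw [show -I * z = I * -z by ring, Complex.log_mul (by simp) (by simpa using hz0), log_I]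
    · ring
    · rw [arg_I]
      constructor <;> linarith [harg.1, harg.2, Real.pi_pos]
  have hzs : z ^ s = exp (s * (log (-z) + Real.pi * I)) := by
    rw [exp_nat_mul, exp_add, exp_log (by simpa using hz0), exp_pi_mul_I]
    simp
  rw [BB, hzs, cpow_def_of_ne_zero (by simpa using hz0), hlog, ← exp_add, ← exp_add]
  congr 1
  ring

lemma res_one (α : ℝ) (s m n : ℕ) :
    ∮ z in C(1, 1 / 2), BB α z * gs s (m + 1) n z = (2 * Real.pi * I / m.factorial) *
      iteratedDeriv m (fun l : ℂ => l ^ ((s : ℂ) - α) * (l + 1) ^ (-(n : ℤ))) 1 := by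
  have hd : DifferentiableOn ℂ (fun z => BB α z * z ^ s * ((z - -1) ^ n)⁻¹)
      (Metric.closedBall 1 (1 / 2)) := by
    intro z hz
    have : z ≠ -1 := by
      rintro rfl
      have := re_pos_of_closedBall hz
      simp at this
      linarith
    exact (((BB_diff α (ball1 hz)).fun_mul (by fun_prop)).fun_mul
      (pow_inv_diff n this)).differentiableWithinAt
  have h2 := hd.circleIntegral_one_div_sub_center_pow_smul (by norm_num) m
  have h3 : (fun l : ℂ => l ^ ((s : ℂ) - α) * (l + 1) ^ (-(n : ℤ))) =ᶠ[𝓝 1]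
      (fun z => BB α z * z ^ s * ((z - -1) ^ n)⁻¹) := by
    filter_upwards [(isOpen_lt continuous_const continuous_re).mem_nhds
      (by simp : (0 : ℝ) < (1 : ℂ).re)] with z hz
    rw [BB_pos α s hz, zpow_neg, zpow_natCast, sub_neg_eq_add]
  rw [h3.iteratedDeriv_eq, ← smul_eq_mul, ← h2]
  congr 1
  ext z
  simp only [gs, smul_eq_mul, sub_neg_eq_add]
  ring

lemma res_neg_one (α : ℝ) (s m n : ℕ) :
    ∮ z in C(-1, 1 / 2), BB α z * gs s m (n + 1) z = (2 * Real.pi * I / n.factorial) *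
      iteratedDeriv n (fun l : ℂ => exp (((s : ℂ) - α) * (log (-l) + Real.pi * I)) *
        (l - 1) ^ (-(m : ℤ))) (-1) := by
  have hd : DifferentiableOn ℂ (fun z => BB α z * z ^ s * ((z - 1) ^ m)⁻¹)
      (Metric.closedBall (-1) (1 / 2)) := by
    intro z hz
    have : z ≠ 1 := by
      rintro rfl
      have := re_neg_of_closedBall hz
      simp at this
      linarith
    exact (((BB_diff α (ball2 hz)).fun_mul (by fun_prop)).fun_mul
      (pow_inv_diff m this)).differentiableWithinAt
  have h2 := hd.circleIntegral_one_div_sub_center_pow_smul (by norm_num) n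
  have h3 : (fun l : ℂ => exp (((s : ℂ) - α) * (log (-l) + Real.pi * I)) *
        (l - 1) ^ (-(m : ℤ))) =ᶠ[𝓝 (-1)]
      (fun z => BB α z * z ^ s * ((z - 1) ^ m)⁻¹) := by
    filter_upwards [(isOpen_lt continuous_re continuous_const).mem_nhds
      (by simp : (-1 : ℂ).re < (0 : ℝ))] with z hz
    rw [BB_neg α s hz, zpow_neg, zpow_natCast]
  rw [h3.iteratedDeriv_eq, ← smul_eq_mul, ← h2]
  congr 1
  ext z
  simp only [gs, smul_eq_mul, sub_neg_eq_add]
  ring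

end MR

/-- Evaluation of the moments `H_s` of the weight `ω(λ)e^{-φ(λ)}` on the ray
`Σ₀ = [0, -i∞)` by residues at `λ = ±1`: the moment integral (parametrized by
`λ = -it`, `t ∈ (0,∞)`) converges absolutely and equals
`2πi e^{iaπ/2} [ D₁/(m-1)! + D₂/(n-1)! ]`, where `D₁` is the `(m-1)`-st derivative
at `λ = 1` of `λ^{s-a/2}(λ+1)^{-n}` (principal branch) and `D₂` the `(n-1)`-st
derivative at `λ = -1` of `λ^{s-a/2}(λ-1)^{-m}` in the branch with
`arg λ ∈ (-π/2, 3π/2)`. -/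
theorem moments_by_residues (a : ℝ) (ha : 0 < a) (ha2 : a < 2)
    (n m : ℕ) (hn : 1 ≤ n) (hm : 1 ≤ m) (hnm : Even (n + m))
    (s : ℕ) (hs : s ≤ n + m - 1) :
    IntegrableOn (fun t : ℝ =>
        (2 * Real.sin (a * Real.pi / 2) : ℝ) *
          Complex.exp (Complex.I * (a : ℂ) * (Real.pi : ℂ) / 4) *
          ((t ^ (-(a / 2)) : ℝ) : ℂ) * (-(Complex.I) * (t : ℂ)) ^ s *
          (-(Complex.I) * (t : ℂ) - 1) ^ (-(m : ℤ)) *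
          (-(Complex.I) * (t : ℂ) + 1) ^ (-(n : ℤ)))
      (Set.Ioi (0 : ℝ)) ∧
    (∫ t : ℝ in Set.Ioi (0 : ℝ),
        (2 * Real.sin (a * Real.pi / 2) : ℝ) *
          Complex.exp (Complex.I * (a : ℂ) * (Real.pi : ℂ) / 4) *
          ((t ^ (-(a / 2)) : ℝ) : ℂ) * (-(Complex.I) * (t : ℂ)) ^ s *
          (-(Complex.I) * (t : ℂ) - 1) ^ (-(m : ℤ)) *
          (-(Complex.I) * (t : ℂ) + 1) ^ (-(n : ℤ))) =
      2 * (Real.pi : ℂ) * Complex.I *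
        Complex.exp (Complex.I * (a : ℂ) * (Real.pi : ℂ) / 2) *
        ((1 / ((m - 1).factorial : ℂ)) *
            iteratedDeriv (m - 1)
              (fun l : ℂ => l ^ ((s : ℂ) - (a : ℂ) / 2) * (l + 1) ^ (-(n : ℤ))) 1 +
          (1 / ((n - 1).factorial : ℂ)) *
            iteratedDeriv (n - 1)
              (fun l : ℂ =>
                Complex.exp (((s : ℂ) - (a : ℂ) / 2) *
                    (Complex.log (-l) + (Real.pi : ℂ) * Complex.I)) *
                  (l - 1) ^ (-(m : ℤ))) (-1)) := by
  obtain ⟨m, rfl⟩ : ∃ k, m = k + 1 := ⟨m - 1, by omega⟩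
  obtain ⟨n, rfl⟩ : ∃ k, n = k + 1 := ⟨n - 1, by omega⟩
  obtain ⟨g1, -, -, g4⟩ := MR.good_gs (α := a / 2) (by linarith) (by linarith) s (m + 1) (n + 1)
    (by omega)
  rw [MR.res_one, MR.res_neg_one] at g4
  have hK : ((2 * Real.sin (a * Real.pi / 2) : ℝ) : ℂ) *
      Complex.exp (Complex.I * (a : ℂ) * (Real.pi : ℂ) / 4) =
      Complex.exp (Complex.I * (a : ℂ) * (Real.pi : ℂ) / 2) * MR.KK (a / 2) := by
    rw [MR.KK]
    have e : Complex.exp (Complex.I * (a : ℂ) * (Real.pi : ℂ) / 4) =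
        Complex.exp (Complex.I * (a : ℂ) * (Real.pi : ℂ) / 2) *
        Complex.exp (-(Complex.I * (Real.pi : ℂ) * ((a / 2 : ℝ) : ℂ) / 2)) := by
      rw [← Complex.exp_add]
      congr 1
      push_cast
      ring
    rw [e]
    push_cast
    rw [show (Real.pi : ℂ) * (a / 2) = a * Real.pi / 2 by ring]
    ring
  have hfun : (fun t : ℝ =>
        ((2 * Real.sin (a * Real.pi / 2) : ℝ) : ℂ) *
          Complex.exp (Complex.I * (a : ℂ) * (Real.pi : ℂ) / 4) *
          ((t ^ (-(a / 2)) : ℝ) : ℂ) * (-(Complex.I) * (t : ℂ)) ^ s *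
          (-(Complex.I) * (t : ℂ) - 1) ^ (-((m + 1 : ℕ) : ℤ)) *
          (-(Complex.I) * (t : ℂ) + 1) ^ (-((n + 1 : ℕ) : ℤ))) = fun t : ℝ =>
      (Complex.exp (Complex.I * (a : ℂ) * (Real.pi : ℂ) / 2) * MR.KK (a / 2)) *
        (((t ^ (-(a / 2)) : ℝ) : ℂ) * MR.gs s (m + 1) (n + 1) (-Complex.I * t)) := by
    ext t
    rw [hK, MR.gs, zpow_neg, zpow_neg, zpow_natCast, zpow_natCast]
    ring
  rw [hfun]
  refine ⟨g1.const_mul _, ?_⟩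
  rw [integral_const_mul, mul_assoc, g4]
  simp only [Nat.add_sub_cancel, Complex.ofReal_div, Complex.ofReal_ofNat]
  ring
end
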